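/- Let V be a quadratic space of maximal Witt index p ≥ 2 over a field of characteristic ≠ 2, 0 < k ≤ p, and W, W' maximal isotropic subspaces with dim(W ∩ W') = p - 1. If ω ∈ Λ^k V is nonzero and Φ_v(ω) = 0 for every isotropic v ∈ W ∪ W', then ω ∈ Λ^k(W^⊥ ∩ W'^⊥). -/

import Mathlib

open ExteriorAlgebra

section Preamble

variable {K V : Type} [Field K] [AddCommGroup V] [Module K V]

/-- A subspace is isotropic for the bilinear form `B`. -/
def IsotropicSub (B : LinearMap.BilinForm K V) (W : Submodule K V) : Prop :=
  ∀ x ∈ W, ∀ y ∈ W, B x y = 0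

/-- A subspace is maximal isotropic for `B`. -/
def MaxIsotropic (B : LinearMap.BilinForm K V) (W : Submodule K V) : Prop :=
  IsotropicSub B W ∧ ∀ W' : Submodule K V, IsotropicSub B W' → W ≤ W' → W' = W

/-- `V` has maximal Witt index `⌊dim V / 2⌋`. -/
def MaxWittIndex (B : LinearMap.BilinForm K V) : Prop :=
  ∃ W : Submodule K V, IsotropicSub B W ∧
    Module.finrank K ↥W = Module.finrank K V / 2

/-- The orthogonal complement `v^⊥` of a vector. -/
def perpV (B : LinearMap.BilinForm K V) (v : V) : Submodule K V :=
  LinearMap.ker (B v)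

/-- The line spanned by `v`, viewed inside `v^⊥`. -/
def lineIn (B : LinearMap.BilinForm K V) (v : V) : Submodule K ↥(perpV B v) :=
  Submodule.comap (perpV B v).subtype (Submodule.span K {v})

/-- The quotient `V_v = v^⊥/⟨v⟩`. -/
abbrev Qt (B : LinearMap.BilinForm K V) (v : V) : Type :=
  ↥(perpV B v) ⧸ lineIn B v

/-- The projection `v^⊥ → v^⊥/⟨v⟩`. -/
def projQ (B : LinearMap.BilinForm K V) (v : V) : ↥(perpV B v) →ₗ[K] Qt B v :=
  (lineIn B v).mkQ

/-- `π : V → V_v` is a linear extension of the canonical projection `v^⊥ → V_v`. -/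
def ExtendsProj (B : LinearMap.BilinForm K V) (v : V) (π : V →ₗ[K] Qt B v) : Prop :=
  ∀ x : ↥(perpV B v), π x.val = projQ B v x

/-- The isotropic-Grassmann-cone-preserving map `Φ_v`, defined as contraction by `⟨v,·⟩`
followed by the map induced by (an extension of) the projection `v^⊥ → v^⊥/⟨v⟩`.
Its restriction to `⋀^k V` does not depend on the chosen extension `π`. -/
noncomputable def Phi (B : LinearMap.BilinForm K V) (v : V) (π : V →ₗ[K] Qt B v) :
    ExteriorAlgebra K V →ₗ[K] ExteriorAlgebra K (Qt B v) :=
  (ExteriorAlgebra.map π).toLinearMap ∘ₗ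
    (CliffordAlgebra.contractLeft (Q := (0 : QuadraticForm K V)) (B v))

/-- The span of the decomposable `m`-vectors with factors in `W`, i.e. `⋀^m W` viewed
inside `⋀^m V`. -/
def epowSub (K : Type) [Field K] {V : Type} [AddCommGroup V] [Module K V]
    (W : Submodule K V) (m : ℕ) : Submodule K (ExteriorAlgebra K V) :=
  Submodule.span K {x | ∃ w : Fin m → V, (∀ i, w i ∈ W) ∧ x = ExteriorAlgebra.ιMulti K m w}

end Preamble

section Aux
variable {K V : Type} [Field K] [AddCommGroup V] [Module K V]

/-- contraction -/
noncomputable abbrev cL (d : Module.Dual K V) : ExteriorAlgebra K V →ₗ[K] ExteriorAlgebra K V :=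
  CliffordAlgebra.contractLeft (Q := (0 : QuadraticForm K V)) d

lemma cL_mul (d : Module.Dual K V) (a : V) (b : ExteriorAlgebra K V) :
    cL d (ι K a * b) = d a • b - ι K a * cL d b :=
  CliffordAlgebra.contractLeft_ι_mul (Q := (0 : QuadraticForm K V)) d a b

lemma cL_add (d d' : Module.Dual K V) (b : ExteriorAlgebra K V) :
    cL (d + d') b = cL d b + cL d' b := by
  simp [cL, map_add]

lemma cL_sq (d : Module.Dual K V) (b : ExteriorAlgebra K V) : cL d (cL d b) = 0 :=
  CliffordAlgebra.contractLeft_contractLeft (Q := (0 : QuadraticForm K V)) d b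

lemma cL_comm (d d' : Module.Dual K V) (b : ExteriorAlgebra K V) :
    cL d (cL d' b) = - cL d' (cL d b) :=
  CliffordAlgebra.contractLeft_comm (Q := (0 : QuadraticForm K V)) d d' b

lemma sw (a b : V) (x : ExteriorAlgebra K V) : ι K a * (ι K b * x) = - (ι K b * (ι K a * x)) := by
  have := ExteriorAlgebra.ι_add_mul_swap (R := K) a b
  rw [← mul_assoc, ← mul_assoc, eq_neg_of_add_eq_zero_left this, neg_mul]

lemma sq0 (a : V) (x : ExteriorAlgebra K V) : ι K a * (ι K a * x) = 0 := by
  rw [← mul_assoc, ExteriorAlgebra.ι_sq_zero, zero_mul]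

lemma ind (P : ExteriorAlgebra K V → Prop) (h0 : P 1) (hs : ∀ (c : K) x, P x → P (c • x))
    (ha : ∀ x y, P x → P y → P (x + y))
    (hm : ∀ (a : V) x, P x → P (ι K a * x)) (x : ExteriorAlgebra K V) : P x := by
  refine CliffordAlgebra.left_induction (Q := (0 : QuadraticForm K V)) (P := P) ?_ ha
    (fun x m h => hm m x h) x
  intro r
  have := hs r 1 h0
  rwa [← Algebra.algebraMap_eq_smul_one] at this

lemma cL_one (d : Module.Dual K V) : cL d (1 : ExteriorAlgebra K V) = 0 :=
  CliffordAlgebra.contractLeft_one (Q := (0 : QuadraticForm K V)) d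

lemma cL_deg0 (d : Module.Dual K V) (x : ExteriorAlgebra K V) (hx : x ∈ ⋀[K]^0 V) :
    cL d x = 0 := by
  rw [exteriorPower, pow_zero, Submodule.mem_one] at hx
  obtain ⟨y, rfl⟩ := hx
  exact CliffordAlgebra.contractLeft_algebraMap (Q := (0 : QuadraticForm K V)) d y

lemma mul_deg (m : ℕ) (a : V) (x : ExteriorAlgebra K V) (hx : x ∈ ⋀[K]^m V) :
    ι K a * x ∈ ⋀[K]^(m+1) V := by
  rw [exteriorPower, pow_succ']
  exact Submodule.mul_mem_mul ⟨a, rfl⟩ hx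

lemma cL_deg (m : ℕ) (d : Module.Dual K V) (x : ExteriorAlgebra K V) (hx : x ∈ ⋀[K]^(m+1) V) :
    cL d x ∈ ⋀[K]^m V := by
  induction m generalizing x with
  | zero =>
    rw [exteriorPower, zero_add, pow_one] at hx
    obtain ⟨y, rfl⟩ := hx
    have := cL_mul d y 1
    rw [mul_one, cL_one, mul_zero, sub_zero] at this
    rw [this, exteriorPower, pow_zero]
    exact Submodule.smul_mem _ _ (Submodule.one_le.mp le_rfl)
  | succ m ih =>
    rw [exteriorPower, pow_succ'] at hx
    induction hx using Submodule.mul_induction_on' with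
    | mem_mul_mem a ha b hb =>
      obtain ⟨a, rfl⟩ := ha
      rw [cL_mul]
      exact Submodule.sub_mem _ (Submodule.smul_mem _ _ hb) (mul_deg _ _ _ (ih b hb))
    | add x _ y _ hx hy => rw [map_add]; exact Submodule.add_mem _ hx hy

/-- projection along `z` -/
noncomputable def pr (d : Module.Dual K V) (z : V) : V →ₗ[K] V :=
  LinearMap.id - d.smulRight z

lemma pr_apply (d : Module.Dual K V) (z x : V) : pr d z x = x - d x • z := by simp [pr]

lemma map_pr (d : Module.Dual K V) (z : V) (x : ExteriorAlgebra K V) :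
    ExteriorAlgebra.map (pr d z) x = x - ι K z * cL d x := by
  refine ind (fun x => ExteriorAlgebra.map (pr d z) x = x - ι K z * cL d x) ?_ ?_ ?_ ?_ x
  · simp [cL_one]
  · intro c x h
    simp only [map_smul, h, smul_sub, mul_smul_comm]
  · intro x y hx hy
    simp only [map_add, hx, hy, mul_add]; abel
  · intro a x hx
    rw [map_mul, hx, ExteriorAlgebra.map_apply_ι, pr_apply, cL_mul]
    simp only [map_sub, map_smul, sub_mul, mul_sub, smul_mul_assoc, sq0, mul_smul_comm, smul_zero]
    rw [sw a z]; abel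

lemma mul_map_congr (v : V) (f g : V →ₗ[K] V) (hfg : ∀ x, f x - g x ∈ Submodule.span K {v})
    (x : ExteriorAlgebra K V) :
    ι K v * ExteriorAlgebra.map f x = ι K v * ExteriorAlgebra.map g x := by
  refine ind (fun x => ι K v * ExteriorAlgebra.map f x = ι K v * ExteriorAlgebra.map g x)
    ?_ ?_ ?_ ?_ x
  · simp
  · intro c x h
    simp only [map_smul, h, mul_smul_comm]
  · intro x y hx hy
    simp only [map_add, hx, hy, mul_add]
  · intro a x hx
    obtain ⟨c, hc⟩ := Submodule.mem_span_singleton.mp (hfg a)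
    have hf : f a = g a + c • v := by rw [hc]; abel
    simp only [map_mul, ExteriorAlgebra.map_apply_ι]
    rw [hf, map_add, add_mul, mul_add, map_smul, smul_mul_assoc, mul_smul_comm, sq0, smul_zero,
      add_zero, sw, hx, sw v]

lemma Phi_zero (B : LinearMap.BilinForm K V) (hB : B.Nondegenerate) (v : V) (hv : v ≠ 0)
    (ω : ExteriorAlgebra K V)
    (h : ∀ π : V →ₗ[K] Qt B v, ExtendsProj B v π → Phi B v π ω = 0) :
    ι K v * cL (B v) ω = 0 := by
  obtain ⟨z, hz⟩ : ∃ z, B v z = 1 := by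
    obtain ⟨y, hy⟩ : ∃ y, B v y ≠ 0 := by
      by_contra! hc
      exact hv (hB.1 v hc)
    exact ⟨(B v y)⁻¹ • y, by simp [hy]⟩
  let P : V →ₗ[K] perpV B v := (pr (B v) z).codRestrict _ (by
    intro x; simp [perpV, pr_apply, hz])
  let π : V →ₗ[K] Qt B v := projQ B v ∘ₗ P
  have hπ : ExtendsProj B v π := by
    intro x
    have : P x.val = x := by
      have h0 : B v x.val = 0 := x.2
      apply Subtype.ext
      change pr (B v) z x.val = x.val
      rw [pr_apply, h0, zero_smul, sub_zero]
    simp [π, this]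
  have h1 := h π hπ
  obtain ⟨s, hs⟩ := (projQ B v).exists_rightInverse_of_surjective
    (LinearMap.range_eq_top.mpr (Submodule.mkQ_surjective _))
  let g : V →ₗ[K] V := (perpV B v).subtype ∘ₗ s ∘ₗ π
  have h2 : ExteriorAlgebra.map g (cL (B v) ω) = 0 := by
    have : ExteriorAlgebra.map g = (ExteriorAlgebra.map ((perpV B v).subtype ∘ₗ s)).comp
      (ExteriorAlgebra.map π) := by
      rw [ExteriorAlgebra.map_comp_map]; rfl
    rw [this, AlgHom.comp_apply]
    have h1' : ExteriorAlgebra.map π (cL (B v) ω) = 0 := h1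
    rw [h1', map_zero]
  have h3 := map_pr (B v) z (cL (B v) ω)
  rw [cL_sq, mul_zero, sub_zero] at h3
  rw [← h3, ← mul_map_congr v g, h2, mul_zero]
  intro x
  have h4 : projQ B v (s (π x) - P x) = 0 := by
    rw [map_sub]
    have := LinearMap.congr_fun hs (π x)
    simp only [LinearMap.comp_apply, LinearMap.id_apply] at this
    rw [this]; simp [π]
  have h5 : s (π x) - P x ∈ lineIn B v := (Submodule.Quotient.mk_eq_zero _).mp h4
  exact h5

lemma eq_mul_cL (d : Module.Dual K V) (e : V) (he : d e = 1) (x : ExteriorAlgebra K V)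
    (hx : ι K e * x = 0) : x = ι K e * cL d x := by
  have := cL_mul d e x
  rw [hx, map_zero, he, one_smul] at this
  exact (sub_eq_zero.mp this.symm)

lemma exists_dual (W : Submodule K V) [FiniteDimensional K W] :
    ∃ (b : Module.Basis (Fin (Module.finrank K W)) K W) (d : Fin (Module.finrank K W) → Module.Dual K V),
      ∀ i j, d i (b j) = if j = i then 1 else 0 := by
  let b := Module.finBasis K W
  have : ∀ i, ∃ d : Module.Dual K V, d ∘ₗ W.subtype = b.coord i := fun i =>
    LinearMap.exists_extend _
  choose d hd using this
  refine ⟨b, d, fun i j => ?_⟩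
  have := LinearMap.congr_fun (hd i) (b j)
  simp only [LinearMap.comp_apply, Submodule.subtype_apply] at this
  rw [this]; simp [Finsupp.single_apply]

lemma kill_aux {ι' : Type} [DecidableEq ι'] (e : ι' → V) (d : ι' → Module.Dual K V)
    (hd : ∀ i j, d i (e j) = if j = i then 1 else 0) (m : ℕ) (s : Finset ι') (hs : m < s.card)
    (x : ExteriorAlgebra K V) (hx : x ∈ ⋀[K]^m V) (h : ∀ i ∈ s, ι K (e i) * x = 0) : x = 0 := by
  induction m generalizing s x with
  | zero =>
    obtain ⟨i, hi⟩ := Finset.card_pos.mp hs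
    rw [eq_mul_cL (d i) (e i) (by simp [hd]) x (h i hi), cL_deg0 _ _ hx, mul_zero]
  | succ m ih =>
    obtain ⟨i, hi⟩ := Finset.card_pos.mp (by omega : 0 < s.card)
    rw [eq_mul_cL (d i) (e i) (by simp [hd]) x (h i hi)]
    rw [ih (s.erase i) (by rw [Finset.card_erase_of_mem hi]; omega) _ (cL_deg _ _ _ hx), mul_zero]
    intro j hj
    have := cL_mul (d i) (e j) x
    rw [h j (Finset.mem_of_mem_erase hj), map_zero, hd, if_neg (Finset.ne_of_mem_erase hj),
      zero_smul, zero_sub] at this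
    exact neg_eq_zero.mp this.symm

lemma kill (U : Submodule K V) [FiniteDimensional K U] (m : ℕ) (hm : m < Module.finrank K U)
    (x : ExteriorAlgebra K V) (hx : x ∈ ⋀[K]^m V) (h : ∀ u ∈ U, ι K u * x = 0) : x = 0 := by
  obtain ⟨b, d, hd⟩ := exists_dual U
  exact kill_aux (fun i => (b i : V)) d hd m Finset.univ (by simpa using hm) x hx
    (fun i _ => h _ (b i).2)

lemma koszul_aux {ι' : Type} [DecidableEq ι'] (e : ι' → V) (d : ι' → Module.Dual K V)
    (hd : ∀ i j, d i (e j) = if j = i then 1 else 0) (m : ℕ) (η : ι' → ExteriorAlgebra K V)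
    (hη : ∀ i, η i ∈ ⋀[K]^(m+1) V) (h0 : ∀ i, ι K (e i) * η i = 0)
    (h1 : ∀ i j, ι K (e i) * η j + ι K (e j) * η i = 0) (s : Finset ι') :
    ∃ θ ∈ ⋀[K]^m V, ∀ i ∈ s, η i = ι K (e i) * θ := by
  induction s using Finset.induction_on with
  | empty => exact ⟨0, Submodule.zero_mem _, by simp⟩
  | insert a s ha ih =>
    obtain ⟨θ, hθ, h⟩ := ih
    set y := η a - ι K (e a) * θ with hy
    have hyd : y ∈ ⋀[K]^(m+1) V := Submodule.sub_mem _ (hη a) (mul_deg _ _ _ hθ)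
    have hya : ι K (e a) * y = 0 := by rw [hy, mul_sub, h0, sq0, sub_zero]
    have hyi : ∀ i ∈ s, ι K (e i) * y = 0 := by
      intro i hi
      rw [hy, mul_sub, sw, ← h i hi, sub_neg_eq_add, h1]
    have hy2 := eq_mul_cL (d a) (e a) (by simp [hd]) y hya
    refine ⟨θ + cL (d a) y, Submodule.add_mem _ hθ (cL_deg _ _ _ hyd), ?_⟩
    intro i hi
    rcases Finset.mem_insert.mp hi with rfl | hi'
    · rw [mul_add, ← hy2, hy]; abel
    · have := cL_mul (d a) (e i) y
      rw [hyi i hi', map_zero, hd, if_neg (by rintro rfl; exact ha hi'),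
        zero_smul, zero_sub] at this
      rw [mul_add, neg_eq_zero.mp this.symm, add_zero, h i hi']

lemma koszul (W : Submodule K V) [FiniteDimensional K W] (m : ℕ)
    (η : V →ₗ[K] ExteriorAlgebra K V) (hη : ∀ v, η v ∈ ⋀[K]^(m+1) V)
    (h : ∀ v ∈ W, ι K v * η v = 0) :
    ∃ θ ∈ ⋀[K]^m V, ∀ v ∈ W, η v = ι K v * θ := by
  obtain ⟨b, d, hd⟩ := exists_dual W
  obtain ⟨θ, hθ, h'⟩ := koszul_aux (fun i => (b i : V)) d hd m (fun i => η (b i))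
    (fun i => hη _) (fun i => h _ (b i).2) (fun i j => by
      have := h _ (W.add_mem (b i).2 (b j).2)
      simp only [map_add, add_mul, mul_add, h _ (b i).2, h _ (b j).2] at this
      simpa [add_comm] using this) Finset.univ
  refine ⟨θ, hθ, fun v hv => ?_⟩
  have key : η ∘ₗ W.subtype = (LinearMap.mulRight K θ ∘ₗ ι K) ∘ₗ W.subtype :=
    b.ext (fun i => by simpa using h' i (Finset.mem_univ i))
  exact LinearMap.congr_fun key ⟨v, hv⟩

lemma main_aux (h2 : (2 : K) ≠ 0) [FiniteDimensional K V]
    (B : LinearMap.BilinForm K V) (hsymm : B.IsSymm) (W W' : Submodule K V)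
    (e f : V) (he : e ∈ W) (hf : f ∈ W') (hef : B e f ≠ 0)
    (hW : IsotropicSub B W) (hW' : IsotropicSub B W') (k : ℕ)
    (hk : k ≤ Module.finrank K ↥(W ⊓ W') + 1) (ω : ExteriorAlgebra K V) (hω : ω ∈ ⋀[K]^k V)
    (h : ∀ v, v ∈ W ∨ v ∈ W' → ι K v * cL (B v) ω = 0) :
    ∀ v, v ∈ W ∨ v ∈ W' → cL (B v) ω = 0 := by
  induction k using Nat.strong_induction_on generalizing ω with
  | _ k ih =>
  match k, hk, hω, ih with
  | 0, hk, hω, ih => exact fun v _ => cL_deg0 _ _ hω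
  | 1, hk, hω, ih =>
    intro v hv
    by_cases hv0 : v = 0
    · subst hv0; simp [cL]
    refine kill (Submodule.span K {v}) 0 (by rw [finrank_span_singleton hv0]; exact one_pos) _
      (cL_deg _ _ _ hω) ?_
    intro u hu
    obtain ⟨c, rfl⟩ := Submodule.mem_span_singleton.mp hu
    rw [map_smul, smul_mul_assoc, h v hv, smul_zero]
  | m+2, hk, hω, ih =>
    let η : V →ₗ[K] ExteriorAlgebra K V :=
      (CliffordAlgebra.contractLeft (Q := (0 : QuadraticForm K V))).flip ω ∘ₗ B
    have hη : ∀ v, η v = cL (B v) ω := fun v => rfl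
    obtain ⟨θ, hθ, h1⟩ := koszul W m η (fun v => cL_deg _ _ _ hω) (fun v hv => h v (Or.inl hv))
    obtain ⟨θ', hθ', h1'⟩ := koszul W' m η (fun v => cL_deg _ _ _ hω) (fun v hv => h v (Or.inr hv))
    have hθθ : θ - θ' = 0 := by
      refine kill (W ⊓ W') m (by omega) _ (Submodule.sub_mem _ hθ hθ') ?_
      intro u hu
      rw [mul_sub, ← h1 u hu.1, ← h1' u hu.2, sub_self]
    obtain rfl := sub_eq_zero.mp hθθ
    have H : ∀ v, v ∈ W ∨ v ∈ W' → cL (B v) ω = ι K v * θ := by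
      rintro v (hv | hv)
      · exact h1 v hv
      · exact h1' v hv
    have I := ih m (by omega) (by omega) θ hθ (by
      intro v hv
      have h3 := cL_sq (B v) ω
      have h4 : B v v = 0 := by
        rcases hv with hv | hv
        · exact hW v hv v hv
        · exact hW' v hv v hv
      rw [H v hv, cL_mul, h4, zero_smul, zero_sub] at h3
      exact neg_eq_zero.mp h3)
    have h5 := cL_comm (B e) (B f) ω
    rw [H e (Or.inl he), H f (Or.inr hf), cL_mul, cL_mul, I e (Or.inl he), I f (Or.inr hf),
      mul_zero, mul_zero, sub_zero, sub_zero, show B f e = B e f from hsymm.eq f e] at h5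
    have h6 : (2 * B e f) • θ = 0 := by
      rw [two_mul, add_smul]
      nth_rewrite 1 [h5]
      exact neg_add_cancel _
    have h7 : θ = 0 := (smul_eq_zero.mp h6).resolve_left (mul_ne_zero h2 hef)
    intro v hv
    rw [H v hv, h7, mul_zero]

lemma epow_map (S T : Submodule K V) (k : ℕ) (g : V →ₗ[K] V) (hg : ∀ x ∈ S, g x ∈ T)
    (ω : ExteriorAlgebra K V) (hω : ω ∈ epowSub K S k) :
    ExteriorAlgebra.map g ω ∈ epowSub K T k := by
  have : epowSub K S k ≤ (epowSub K T k).comap (ExteriorAlgebra.map g).toLinearMap := by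
    refine Submodule.span_le.mpr ?_
    rintro _ ⟨w, hw, rfl⟩
    refine Submodule.subset_span ⟨g ∘ w, fun i => hg _ (hw i), ?_⟩
    exact ExteriorAlgebra.map_apply_ιMulti g w
  exact this hω

lemma epow_step (S : Submodule K V) (k : ℕ) (d : Module.Dual K V)
    (ω : ExteriorAlgebra K V) (hω : ω ∈ epowSub K S k) (h : cL d ω = 0) :
    ω ∈ epowSub K (LinearMap.ker d ⊓ S) k := by
  by_cases hS : ∀ x ∈ S, d x = 0
  · rwa [inf_eq_right.mpr (fun x hx => LinearMap.mem_ker.mpr (hS x hx))]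
  push Not at hS
  obtain ⟨z, hz, hdz⟩ := hS
  have h1 := map_pr d ((d z)⁻¹ • z) ω
  rw [h, mul_zero, sub_zero] at h1
  rw [← h1]
  refine epow_map S _ k _ ?_ ω hω
  intro x hx
  rw [pr_apply]
  refine ⟨?_, S.sub_mem hx (S.smul_mem _ (S.smul_mem _ hz))⟩
  simp [hdz]

lemma epow_fin (B : LinearMap.BilinForm K V) (k : ℕ) (ω : ExteriorAlgebra K V)
    (hω : ω ∈ ⋀[K]^k V) (s : Set V) (hs : s.Finite) (h : ∀ v ∈ s, cL (B v) ω = 0) :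
    ω ∈ epowSub K (⨅ v ∈ s, LinearMap.ker (B v)) k := by
  induction s, hs using Set.Finite.induction_on with
  | empty =>
    rw [← ExteriorAlgebra.ιMulti_span_fixedDegree] at hω
    refine Submodule.span_mono ?_ hω
    rintro _ ⟨w, rfl⟩
    exact ⟨w, by simp, rfl⟩
  | insert _ _ ih =>
    rw [iInf_insert]
    exact epow_step _ _ _ _ (ih fun v hv => h v (Set.mem_insert_of_mem _ hv))
      (h _ (Set.mem_insert _ _))

end Aux

/-- Let `p = ⌊dim V/2⌋ ≥ 2` be the (maximal) Witt index, `0 < k ≤ p`, and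
`W, W'` maximal isotropic with `dim (W ∩ W') = p - 1`. If `ω ∈ Λ^k V` is nonzero and
`Φ_v(ω) = 0` for every (nonzero) isotropic `(v ∈ W ∨ v ∈ W')`, then `ω ∈ Λ^k(W^⊥ ∩ W'^⊥)`. -/
theorem mem_epow_perp_of_Phi_eq_zero (K V : Type) [Field K] [AddCommGroup V] [Module K V]
    [FiniteDimensional K V] (h2 : (2 : K) ≠ 0)
    (B : LinearMap.BilinForm K V) (hsymm : B.IsSymm) (hB : B.Nondegenerate)
    (hWitt : MaxWittIndex B)
    (hp : 2 ≤ Module.finrank K V / 2)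
    (W W' : Submodule K V) (hW : MaxIsotropic B W) (hW' : MaxIsotropic B W')
    (hWW' : Module.finrank K ↥(W ⊓ W') = Module.finrank K V / 2 - 1)
    (k : ℕ) (hk : 0 < k) (hkp : k ≤ Module.finrank K V / 2)
    (ω : ExteriorAlgebra K V) (hω : ω ∈ ⋀[K]^k V) (hω0 : ω ≠ 0)
    (h : ∀ v : V, v ≠ 0 → (v ∈ W ∨ v ∈ W') → B v v = 0 →
      ∀ π : V →ₗ[K] Qt B v, ExtendsProj B v π → Phi B v π ω = 0) :
    ω ∈ epowSub K (B.orthogonal W ⊓ B.orthogonal W') k := by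
  obtain ⟨U, hU, hUp⟩ := hWitt
  have hWne : W ≠ W' := by
    rintro rfl
    rw [inf_idem] at hWW'
    have h1 := LinearMap.BilinForm.finrank_orthogonal hB W
    have h3 := LinearMap.BilinForm.finrank_orthogonal hB (U ⊓ W)
    have h4 := Submodule.finrank_sup_add_finrank_inf_eq U (B.orthogonal W)
    have h5 : U ⊔ B.orthogonal W ≤ B.orthogonal (U ⊓ W) := by
      refine sup_le ?_ ?_
      · intro x hx y hy
        exact hU y hy.1 x hx
      · intro x hx y hy
        exact hx y hy.2
    have h6 := Submodule.finrank_mono h5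
    have h7 : Module.finrank K ↥(U ⊓ W) ≤ Module.finrank K W := Submodule.finrank_mono inf_le_right
    have h8 : ¬ (U ⊓ B.orthogonal W ≤ U ⊓ W) := by
      intro hle
      have := Submodule.finrank_mono hle
      omega
    rw [SetLike.not_le_iff_exists] at h8
    obtain ⟨x, ⟨hxU, hxW⟩, hx⟩ := h8
    have hx' : x ∉ W := fun hc => hx ⟨hxU, hc⟩
    apply hx'
    have := hW.2 (W ⊔ Submodule.span K {x}) ?_ le_sup_left
    · rw [← this]
      exact Submodule.mem_sup_right (Submodule.mem_span_singleton_self x)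
    · intro a ha b hb
      obtain ⟨a1, ha1, a2, ha2, rfl⟩ := Submodule.mem_sup.mp ha
      obtain ⟨b1, hb1, b2, hb2, rfl⟩ := Submodule.mem_sup.mp hb
      obtain ⟨c, rfl⟩ := Submodule.mem_span_singleton.mp ha2
      obtain ⟨c', rfl⟩ := Submodule.mem_span_singleton.mp hb2
      have e1 : B a1 x = 0 := hxW a1 ha1
      have e2 : B x b1 = 0 := by rw [← hsymm.eq]; exact hxW b1 hb1
      simp [hW.1 a1 ha1 b1 hb1, e1, e2, hU x hxU x hxU]
  obtain ⟨e, he, f, hf, hef⟩ : ∃ e ∈ W, ∃ f ∈ W', B e f ≠ 0 := by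
    by_contra! hc
    have hI : IsotropicSub B (W ⊔ W') := by
      intro a ha b hb
      obtain ⟨a1, ha1, a2, ha2, rfl⟩ := Submodule.mem_sup.mp ha
      obtain ⟨b1, hb1, b2, hb2, rfl⟩ := Submodule.mem_sup.mp hb
      have e2 : B a2 b1 = 0 := by rw [← hsymm.eq]; exact hc b1 hb1 a2 ha2
      simp [hW.1 a1 ha1 b1 hb1, hc a1 ha1 b2 hb2, e2, hW'.1 a2 ha2 b2 hb2]
    exact hWne ((hW.2 _ hI le_sup_left).symm.trans (hW'.2 _ hI le_sup_right))
  have key := main_aux h2 B hsymm W W' e f he hf hef hW.1 hW'.1 k (by omega) ω hω (by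
    intro v hv
    by_cases hv0 : v = 0
    · subst hv0; simp
    refine Phi_zero B hB v hv0 ω (h v hv0 hv ?_)
    rcases hv with hv | hv
    · exact hW.1 v hv v hv
    · exact hW'.1 v hv v hv)
  obtain ⟨s, hs⟩ := (IsNoetherian.noetherian W : W.FG)
  obtain ⟨t, ht⟩ := (IsNoetherian.noetherian W' : W'.FG)
  have hfin := epow_fin B k ω hω ((s : Set V) ∪ (t : Set V))
    (s.finite_toSet.union t.finite_toSet) (by
      rintro v (hv | hv)
      · exact key v (Or.inl (hs ▸ Submodule.subset_span hv))
      · exact key v (Or.inr (ht ▸ Submodule.subset_span hv)))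
  refine Submodule.span_mono ?_ hfin
  rintro _ ⟨w, hw, rfl⟩
  refine ⟨w, fun i => ?_, rfl⟩
  have hwi : ∀ v ∈ ((s : Set V) ∪ (t : Set V)), B v (w i) = 0 := by
    intro v hv
    have := hw i
    simp only [Submodule.mem_iInf] at this
    exact this v hv
  have hle : ∀ r : Finset V, (∀ v ∈ r, B v (w i) = 0) → ∀ v ∈ Submodule.span K (r : Set V),
      B v (w i) = 0 := by
    intro r hr v hv
    have : Submodule.span K (r : Set V) ≤ LinearMap.ker (B.flip (w i)) :=
      Submodule.span_le.mpr (fun x hx => hr x hx)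
    exact this hv
  refine ⟨fun v hv => ?_, fun v hv => ?_⟩
  · exact hle s (fun v hv => hwi v (Or.inl hv)) v (hs ▸ hv)
  · exact hle t (fun v hv => hwi v (Or.inr hv)) v (ht ▸ hv)
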